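/- For every f ∈ V_A^ℬ, the ℬ[H]-submodule generated by f equals I_f · V_A^ℬ, where I_f is the ideal of ℬ generated by the set of values {f(h) : h ∈ H}. -/

import Mathlib

set_option maxHeartbeats 1000000
set_option synthInstance.maxHeartbeats 1000000

noncomputable section

open scoped TensorProduct

/-! ## The base ring `𝒜`: the integral closure of `ℤ[1/p]` in a cyclotomic field -/

instance cycloAlgebra (p : ℕ) [NeZero p] (m : ℕ+) :
    Algebra (Localization.Away (p : ℤ)) (CyclotomicField m ℚ) :=
  (Localization.awayLift (algebraMap ℤ (CyclotomicField m ℚ)) _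
    (by
      rw [map_natCast]
      have h1 : IsUnit ((p : ℕ) : ℚ) :=
        isUnit_iff_ne_zero.mpr (Nat.cast_ne_zero.mpr (NeZero.ne p))
      have h2 := h1.map (algebraMap ℚ (CyclotomicField m ℚ))
      rwa [map_natCast] at h2)).toAlgebra

/-- The integral closure of `ℤ[1/p]` in the `m`-th cyclotomic field `ℚ(ζ_m)`. -/
def Aint (p : ℕ) [NeZero p] (m : ℕ+) :
    Subalgebra (Localization.Away (p : ℤ)) (CyclotomicField m ℚ) :=
  integralClosure (Localization.Away (p : ℤ)) (CyclotomicField m ℚ)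

/-- The ring `𝒜` associated to a finite field of characteristic `p` : the integral
closure of `ℤ[1/p]` in `ℚ(ζ_p)`. -/
def AA (p : ℕ+) : Type := ↥(Aint (p : ℕ) p)

instance (p : ℕ+) : CommRing (AA p) := inferInstanceAs (CommRing ↥(Aint (p : ℕ) p))

attribute [irreducible] AA

/-! ## The Heisenberg group -/

variable {F : Type*} [Field F] {W : Type*} [AddCommGroup W] [Module F W]

/-- The Heisenberg group attached to the bilinear form `β` : the set `W × F` with
multiplication `(w,t)(w',t') = (w+w', t+t'+½⟨w,w'⟩)`. -/
@[ext]
structure Heis (β : W →ₗ[F] W →ₗ[F] F) : Type _ where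
  w : W
  t : F

namespace Heis

variable {β : W →ₗ[F] W →ₗ[F] F}

instance : Mul (Heis β) :=
  ⟨fun a b => ⟨a.w + b.w, a.t + b.t + (2 : F)⁻¹ * β a.w b.w⟩⟩

instance : One (Heis β) := ⟨⟨0, 0⟩⟩

instance : Inv (Heis β) :=
  ⟨fun a => ⟨-a.w, -a.t + (2 : F)⁻¹ * β a.w a.w⟩⟩

@[simp] lemma mul_w (a b : Heis β) : (a * b).w = a.w + b.w := rfl
@[simp] lemma mul_t (a b : Heis β) :
    (a * b).t = a.t + b.t + (2 : F)⁻¹ * β a.w b.w := rfl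
@[simp] lemma one_w : (1 : Heis β).w = 0 := rfl
@[simp] lemma one_t : (1 : Heis β).t = 0 := rfl
@[simp] lemma inv_w (a : Heis β) : a⁻¹.w = -a.w := rfl
@[simp] lemma inv_t (a : Heis β) :
    a⁻¹.t = -a.t + (2 : F)⁻¹ * β a.w a.w := rfl

instance : Group (Heis β) where
  mul_assoc a b c := by
    ext
    · simp [add_assoc]
    · simp [map_add, LinearMap.add_apply]
      ring
  one_mul a := by ext <;> simp
  mul_one a := by ext <;> simp
  inv_mul_cancel a := by
    ext
    · simp
    · simp [map_neg, LinearMap.neg_apply]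

end Heis

/-! ## The induced representation `V_A^ℬ = ind_{A_H}^H(ψ_A^ℬ)` -/

/-- The compactly induced representation `ind_{A_H}^H ψ_A^ℬ`, realised as the
`ℬ`-submodule of functions `f : H → ℬ` with `f(ah) = ψ_A^ℬ(a) f(h)` for `a ∈ A_H`. -/
def IndV (β : W →ₗ[F] W →ₗ[F] F) (ℬ : Type*) [CommRing ℬ] (A : AddSubgroup W)
    (χ : Heis β → ℬˣ) : Submodule ℬ (Heis β → ℬ) where
  carrier := {f | ∀ a : Heis β, a.w ∈ A → ∀ h : Heis β, f (a * h) = (χ a : ℬ) * f h}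
  add_mem' := by
    intro f g hf hg a ha h
    simp only [Pi.add_apply, hf a ha h, hg a ha h, mul_add]
  zero_mem' := by intro a ha h; simp
  smul_mem' := by
    intro c f hf a ha h
    simp only [Pi.smul_apply, smul_eq_mul, hf a ha h]
    ring

/-- Right translation action of `h₀ ∈ H` on functions `H → ℬ`. -/
def hAct (β : W →ₗ[F] W →ₗ[F] F) (ℬ : Type*) [CommRing ℬ] (h₀ : Heis β) :
    (Heis β → ℬ) →ₗ[ℬ] (Heis β → ℬ) where
  toFun f := fun h => f (h * h₀)
  map_add' _ _ := rfl
  map_smul' _ _ := rfl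

lemma hAct_mem (β : W →ₗ[F] W →ₗ[F] F) (ℬ : Type*) [CommRing ℬ] (A : AddSubgroup W)
    (χ : Heis β → ℬˣ) (h₀ : Heis β) (f : Heis β → ℬ) (hf : f ∈ IndV β ℬ A χ) :
    hAct β ℬ h₀ f ∈ IndV β ℬ A χ := by
  intro a ha h
  simpa [hAct, mul_assoc] using hf a ha (h * h₀)

/-- The action `ρ` of the Heisenberg group on `V_A^ℬ`. -/
def hActV (β : W →ₗ[F] W →ₗ[F] F) (ℬ : Type*) [CommRing ℬ] (A : AddSubgroup W)
    (χ : Heis β → ℬˣ) (h₀ : Heis β) :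
    ↥(IndV β ℬ A χ) →ₗ[ℬ] ↥(IndV β ℬ A χ) :=
  (hAct β ℬ h₀).restrict fun f hf => hAct_mem β ℬ A χ h₀ f hf

/-! ## The symplectic group and its action on the Heisenberg group -/

/-- Action of a linear automorphism `g` on the Heisenberg group: `g·(w,t) = (gw,t)`. -/
def gHeis (β : W →ₗ[F] W →ₗ[F] F) (g : W ≃ₗ[F] W) : Heis β → Heis β :=
  fun h => ⟨g h.w, h.t⟩

/-- The symplectic group `Sp(W)` of the form `β`, as a subgroup of the linear
automorphism group of `W`. -/
def SpGrp (β : W →ₗ[F] W →ₗ[F] F) : Subgroup (W ≃ₗ[F] W) where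
  carrier := {g | ∀ u v : W, β (g u) (g v) = β u v}
  one_mem' := fun _ _ => rfl
  mul_mem' := by
    intro g g' hg hg' u v
    have h : ∀ x, (g * g') x = g (g' x) := fun _ => rfl
    rw [h, h, hg, hg']
  inv_mem' := by
    intro g hg u v
    have h1 := hg (g⁻¹ u) (g⁻¹ v)
    have h2 : ∀ x, g (g⁻¹ x) = x := fun x => g.apply_symm_apply x
    rw [h2, h2] at h1
    exact h1.symm

/-- The defining condition of the metaplectic group over `ℬ` : pairs `(g, M)` with
`g ∈ Sp(W)` and `M ∘ ρ(h) = ρ(g·h) ∘ M` for all `h ∈ H`. -/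
def MetaCond (β : W →ₗ[F] W →ₗ[F] F) (ℬ : Type*) [CommRing ℬ] (A : AddSubgroup W)
    (χ : Heis β → ℬˣ)
    (x : (W ≃ₗ[F] W) × (↥(IndV β ℬ A χ) ≃ₗ[ℬ] ↥(IndV β ℬ A χ))) : Prop :=
  (∀ u v : W, β (x.1 u) (x.1 v) = β u v) ∧
    ∀ (h₀ : Heis β) (f : ↥(IndV β ℬ A χ)),
      x.2 (hActV β ℬ A χ h₀ f) = hActV β ℬ A χ (gHeis β x.1 h₀) (x.2 f)

/-- The character `ψ_A^ℬ = φ ∘ ψ_A` of `A_H` with values in `ℬˣ`, obtained from a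
character with values in `𝒜ˣ` via the structure morphism `φ : 𝒜 → ℬ`. -/
def chB (p : ℕ+) (ℬ : Type*) [CommRing ℬ] [Algebra (AA p) ℬ]
    {β : W →ₗ[F] W →ₗ[F] F} (ψA : Heis β → (AA p)ˣ) : Heis β → ℬˣ :=
  fun h => Units.map (algebraMap (AA p) ℬ).toMonoidHom (ψA h)

/-- The character `ψ^ℬ = φ ∘ ψ` of `F` with values in `ℬˣ`. -/
def psB (p : ℕ+) (ℬ : Type*) [CommRing ℬ] [Algebra (AA p) ℬ]
    (ψ : F → (AA p)ˣ) : F → ℬˣ :=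
  fun t => Units.map (algebraMap (AA p) ℬ).toMonoidHom (ψ t)

/-! ## The base ring: no zero divisors, and `p` is invertible -/

instance AA.instIsDomain (p : ℕ+) : IsDomain (AA p) := by
  with_unfolding_all exact inferInstanceAs (IsDomain ↥(Aint (p : ℕ) p))

lemma AA.isUnit_natCast (p : ℕ+) : IsUnit ((p : ℕ) : AA p) := by
  have h : IsUnit ((p : ℕ) : ↥(Aint (p : ℕ) p)) := by
    have h := (IsLocalization.Away.algebraMap_isUnit
      (S := Localization.Away ((p : ℕ) : ℤ)) ((p : ℕ) : ℤ)).map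
      (algebraMap (Localization.Away ((p : ℕ) : ℤ)) ↥(Aint (p : ℕ) p))
    simpa using h
  with_unfolding_all exact h

namespace Heis

variable {β : W →ₗ[F] W →ₗ[F] F}

/-- The Heisenberg group has underlying set `W × F`. -/
def equivProd (β : W →ₗ[F] W →ₗ[F] F) : Heis β ≃ W × F where
  toFun h := (h.w, h.t)
  invFun x := ⟨x.1, x.2⟩
  left_inv _ := rfl
  right_inv _ := rfl

/-- The subgroup `A_H = A × F` of the Heisenberg group. -/
def preimage (β : W →ₗ[F] W →ₗ[F] F) (A : AddSubgroup W) : Subgroup (Heis β) where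
  carrier := {a | a.w ∈ A}
  one_mem' := A.zero_mem
  mul_mem' := A.add_mem
  inv_mem' := A.neg_mem

lemma mul_eq_central_mul_mul (halt : ∀ v : W, β v v = 0) (h2 : (2 : F) ≠ 0) (x a : Heis β) :
    x * a = (⟨0, β x.w a.w⟩ * a) * x := by
  have hs : β a.w x.w = -β x.w a.w := by
    have h := halt (a.w + x.w)
    simp only [map_add, LinearMap.add_apply, halt] at h
    linear_combination h
  ext
  · simp [add_comm]
  · simp [hs]
    field_simp
    ring

/-- The order of `A_H` is a power of the characteristic. -/
lemma exists_card_preimage_eq_pow {p : ℕ} [Fact p.Prime] [Finite F] [CharP F p]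
    [FiniteDimensional F W] (A : AddSubgroup W) :
    ∃ n, Nat.card (preimage β A) = p ^ n := by
  have := Fintype.ofFinite F
  obtain ⟨m, -, hm⟩ := FiniteField.card F p
  have hdvd := (preimage β A).card_subgroup_dvd_card
  rw [Nat.card_congr (equivProd β), Nat.card_prod, Module.natCard_eq_pow_finrank (K := F) (V := W),
    Nat.card_eq_fintype_card (α := F), hm, ← pow_mul, ← pow_add] at hdvd
  obtain ⟨n, -, hn⟩ := (Nat.dvd_prime_pow (Fact.out : p.Prime)).1 hdvd
  exact ⟨n, hn⟩

end Heis

open Heis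

/-! ## Functions supported on a single coset of `A_H` -/

section coset

variable {β : W →ₗ[F] W →ₗ[F] F} {ℬ : Type*} [CommRing ℬ] {A : AddSubgroup W}
  {χ : Heis β → ℬˣ}

open Classical in
/-- The function supported on the coset `A_H k` with value `χ a` at `a * k`. -/
def cosetFun (A : AddSubgroup W) (χ : Heis β → ℬˣ) (k : Heis β) : Heis β → ℬ :=
  fun h => if (h * k⁻¹).w ∈ A then (χ (h * k⁻¹) : ℬ) else 0

lemma cosetFun_mem (hχ : ∀ a b : Heis β, a.w ∈ A → b.w ∈ A → χ (a * b) = χ a * χ b)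
    (k : Heis β) : cosetFun A χ k ∈ IndV β ℬ A χ := by
  intro a ha h
  have hmem : (a * h * k⁻¹).w ∈ A ↔ (h * k⁻¹).w ∈ A := by
    rw [mul_assoc, mul_w a, A.add_mem_cancel_left ha]
  by_cases hk : (h * k⁻¹).w ∈ A
  · rw [cosetFun, cosetFun, if_pos hk, if_pos (hmem.2 hk), mul_assoc, hχ a _ ha hk, Units.val_mul]
  · rw [cosetFun, cosetFun, if_neg hk, if_neg (mt hmem.1 hk), mul_zero]

lemma hAct_cosetFun (h₀ k : Heis β) :
    hAct β ℬ h₀ (cosetFun A χ k) = cosetFun A χ (k * h₀⁻¹) := by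
  funext h
  have he : h * h₀ * k⁻¹ = h * (k * h₀⁻¹)⁻¹ := by group
  change cosetFun A χ k (h * h₀) = _
  rw [cosetFun, cosetFun, he]

open Classical in
lemma apply_mul_cosetFun {f : Heis β → ℬ} (hf : f ∈ IndV β ℬ A χ) (h k : Heis β) :
    f k * cosetFun A χ k h = if (h * k⁻¹).w ∈ A then f h else 0 := by
  simp only [cosetFun]
  split_ifs with hk
  · have := hf _ hk k
    rw [inv_mul_cancel_right] at this
    rw [this, mul_comm]
  · simp

lemma sum_apply_smul_cosetFun [Fintype (Heis β)] {f : Heis β → ℬ} (hf : f ∈ IndV β ℬ A χ) :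
    ∑ k, f k • cosetFun A χ k = (Nat.card (preimage β A) : ℬ) • f := by
  classical
  funext h
  have hcard : (Finset.univ.filter fun k : Heis β => (h * k⁻¹).w ∈ A).card =
      Nat.card (preimage β A) := by
    rw [← Fintype.card_subtype, ← Nat.card_eq_fintype_card]
    exact Nat.card_congr
      (((Equiv.inv (Heis β)).trans (Equiv.mulLeft h)).subtypeEquiv fun _ => Iff.rfl)
  simp only [Finset.sum_apply, Pi.smul_apply, smul_eq_mul, apply_mul_cosetFun hf]
  rw [← Finset.sum_filter, Finset.sum_const, hcard, nsmul_eq_mul]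

/-- Summing the translates of `f` by the conjugates `k⁻¹ a k`, weighted by `χ(a)⁻¹`, over
`a ∈ A_H` isolates the coset `A_H k`. -/
lemma sum_inv_smul_hAct [Fintype (preimage β A)] (halt : ∀ v : W, β v v = 0) (h2 : (2 : F) ≠ 0)
    (hχ : ∀ a b : Heis β, a.w ∈ A → b.w ∈ A → χ (a * b) = χ a * χ b)
    (horth : ∀ v ∉ A, ∑ a : preimage β A, (χ ⟨0, β v a.1.w⟩ : ℬ) = 0)
    (hone : ∀ v ∈ A, ∀ a ∈ A, χ ⟨0, β v a⟩ = 1)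
    {f : Heis β → ℬ} (hf : f ∈ IndV β ℬ A χ) (k : Heis β) :
    ∑ a : preimage β A, ((χ a.1)⁻¹ : ℬˣ).val • hAct β ℬ (k⁻¹ * a.1 * k) f =
      (Nat.card (preimage β A) : ℬ) • f k • cosetFun A χ k := by
  classical
  funext h
  have hterm (a : preimage β A) : ((χ a.1)⁻¹ : ℬˣ).val * f (h * (k⁻¹ * a.1 * k)) =
      (χ ⟨0, β (h * k⁻¹).w a.1.w⟩ : ℬ) * f h := by
    have hc : (⟨0, β (h * k⁻¹).w a.1.w⟩ : Heis β).w ∈ A := A.zero_mem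
    have he : h * (k⁻¹ * a.1 * k) = (⟨0, β (h * k⁻¹).w a.1.w⟩ * a.1) * h := by
      calc h * (k⁻¹ * a.1 * k) = ((h * k⁻¹) * a.1) * k := by group
        _ = _ := by rw [mul_eq_central_mul_mul halt h2 (h * k⁻¹) a.1]; group
    rw [he, hf _ (A.add_mem hc a.2), hχ _ _ hc a.2, Units.val_mul,
      mul_comm _ (χ a.1 : ℬ), mul_assoc, Units.inv_mul_cancel_left]
  simp only [Finset.sum_apply, Pi.smul_apply, smul_eq_mul, apply_mul_cosetFun hf]
  simp only [hAct, LinearMap.coe_mk, AddHom.coe_mk, hterm]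
  rw [← Finset.sum_mul]
  split_ifs with hk
  · rw [Finset.sum_congr rfl fun a _ => by rw [hone _ hk _ a.2, Units.val_one]]
    rw [Finset.sum_const, Finset.card_univ, nsmul_one, Nat.card_eq_fintype_card]
  · rw [horth _ hk, zero_mul, mul_zero]

lemma hAct_mem_span_hAct (f : Heis β → ℬ) (h₀ : Heis β) {g : Heis β → ℬ}
    (hg : g ∈ Submodule.span ℬ (Set.range fun k : Heis β => hAct β ℬ k f)) :
    hAct β ℬ h₀ g ∈ Submodule.span ℬ (Set.range fun k : Heis β => hAct β ℬ k f) := by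
  induction hg using Submodule.span_induction with
  | mem g hg =>
    obtain ⟨k, rfl⟩ := hg
    exact Submodule.subset_span ⟨h₀ * k, by funext h; simp [hAct, mul_assoc]⟩
  | zero => simp
  | add x y _ _ hx hy => rw [map_add]; exact add_mem hx hy
  | smul c x _ hx => rw [map_smul]; exact Submodule.smul_mem _ c hx

theorem span_hAct_eq_ideal_smul [Finite (Heis β)] (halt : ∀ v : W, β v v = 0) (h2 : (2 : F) ≠ 0)
    [Fintype (preimage β A)]
    (hχ : ∀ a b : Heis β, a.w ∈ A → b.w ∈ A → χ (a * b) = χ a * χ b)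
    (horth : ∀ v ∉ A, ∑ a : preimage β A, (χ ⟨0, β v a.1.w⟩ : ℬ) = 0)
    (hone : ∀ v ∈ A, ∀ a ∈ A, χ ⟨0, β v a⟩ = 1)
    (hunit : IsUnit (Nat.card (preimage β A) : ℬ))
    {f : Heis β → ℬ} (hf : f ∈ IndV β ℬ A χ) :
    Submodule.span ℬ (Set.range fun h₀ : Heis β => hAct β ℬ h₀ f) =
      Ideal.span (Set.range f) • IndV β ℬ A χ := by
  have := Fintype.ofFinite (Heis β)
  apply le_antisymm
  · rw [Submodule.span_le]
    rintro _ ⟨h₀, rfl⟩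
    rw [SetLike.mem_coe, ← Submodule.smul_mem_iff_of_isUnit _ hunit,
      ← sum_apply_smul_cosetFun (hAct_mem β ℬ A χ h₀ f hf)]
    exact sum_mem fun k _ => Submodule.smul_mem_smul (Ideal.subset_span ⟨k * h₀, rfl⟩)
      (cosetFun_mem hχ k)
  · have hself (k : Heis β) : f k • cosetFun A χ k ∈
        Submodule.span ℬ (Set.range fun h₀ : Heis β => hAct β ℬ h₀ f) := by
      rw [← Submodule.smul_mem_iff_of_isUnit _ hunit,
        ← sum_inv_smul_hAct halt h2 hχ horth hone hf k]
      exact sum_mem fun a _ => Submodule.smul_mem _ _ (Submodule.subset_span ⟨_, rfl⟩)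
    have hall (h k : Heis β) : f h • cosetFun A χ k ∈
        Submodule.span ℬ (Set.range fun h₀ : Heis β => hAct β ℬ h₀ f) := by
      have := hAct_mem_span_hAct f (k⁻¹ * h) (hself h)
      rw [map_smul, hAct_cosetFun] at this
      simpa using this
    refine Submodule.smul_le.2 fun r hr v hv => ?_
    rw [← Submodule.smul_mem_iff_of_isUnit _ hunit, smul_comm, ← sum_apply_smul_cosetFun hv,
      Finset.smul_sum]
    refine sum_mem fun k _ => ?_
    rw [smul_comm]
    refine Submodule.smul_mem _ _ ?_
    induction hr using Submodule.span_induction with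
    | mem r hr =>
      obtain ⟨h, rfl⟩ := hr
      exact hall h k
    | zero => simp
    | add x y _ _ hx hy => rw [add_smul]; exact add_mem hx hy
    | smul c x _ hx => rw [smul_assoc]; exact Submodule.smul_mem _ c hx

end coset

/-- For every `f ∈ V_A^ℬ`, the `ℬ[H]`-submodule generated by `f`
(the `ℬ`-span of the `H`-translates of `f`) equals `I_f · V_A^ℬ`, where `I_f` is the
ideal of `ℬ` generated by the values of `f`. -/
theorem statement_18
    (p : ℕ+) [Fact (Nat.Prime (p : ℕ))] (hp2 : (p : ℕ) ≠ 2)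
    {F : Type*} [Field F] [Fintype F] [CharP F (p : ℕ)]
    {W : Type*} [AddCommGroup W] [Module F W] [FiniteDimensional F W]
    (β : W →ₗ[F] W →ₗ[F] F)
    (halt : ∀ v : W, β v v = 0)
    (hnd : ∀ v : W, (∀ u : W, β v u = 0) → v = 0)
    (ℬ : Type*) [CommRing ℬ] [Algebra (AA p) ℬ]
    (ψ : F → (AA p)ˣ) (hψ : ∀ x y : F, ψ (x + y) = ψ x * ψ y)
    (hψnt : ∃ x : F, ψ x ≠ 1)
    (A : AddSubgroup W)
    (hA : ∀ v : W, (∀ a ∈ A, ψ (β v a) = 1) ↔ v ∈ A)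
    (ψA : Heis β → (AA p)ˣ)
    (hψA : ∀ a b : Heis β, a.w ∈ A → b.w ∈ A → ψA (a * b) = ψA a * ψA b)
    (hψAext : ∀ t : F, ψA ⟨0, t⟩ = ψ t) :
    ∀ f ∈ IndV β ℬ A (chB p ℬ ψA),
      Submodule.span ℬ (Set.range fun h₀ : Heis β => hAct β ℬ h₀ f) =
        Ideal.span (Set.range f) • IndV β ℬ A (chB p ℬ ψA) := by
  intro f hf
  have : Finite W := Module.finite_of_finite F
  have : Finite (Heis β) := Finite.of_equiv _ (equivProd β).symm
  have := Fintype.ofFinite (preimage β A)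
  have h2 : (2 : F) ≠ 0 := Ring.two_ne_zero (by rwa [ringChar.eq F (p : ℕ)])
  obtain ⟨n, hn⟩ := exists_card_preimage_eq_pow (p := (p : ℕ)) (β := β) A
  have hψ0 : ψ 0 = 1 := by simpa using hψ 0 0
  refine span_hAct_eq_ideal_smul halt h2 ?_ ?_ ?_ ?_ hf
  · intro a b ha hb
    simp only [chB, hψA a b ha hb, map_mul]
  · intro v hv
    let c : preimage β A →* AA p :=
      { toFun := fun a => (ψ (β v a.1.w) : AA p)
        map_one' := by simp [hψ0]
        map_mul' := fun a b => by simp [hψ] }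
    have hc : c ≠ 1 := by
      intro hc
      refine hv ((hA v).1 fun a ha => Units.ext ?_)
      exact DFunLike.congr_fun hc (⟨⟨a, 0⟩, ha⟩ : preimage β A)
    have hsum := congrArg (algebraMap (AA p) ℬ) (sum_hom_units_eq_zero c hc)
    rw [map_sum, map_zero] at hsum
    simpa [chB, hψAext, c] using hsum
  · intro v hv a ha
    simp only [chB, hψAext, (hA v).2 hv a ha, map_one]
  · rw [hn, Nat.cast_pow]
    simpa using ((AA.isUnit_natCast p).map (algebraMap (AA p) ℬ)).pow n
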